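/- For any finite connected simple graphs G and H of orders n_1 and n_2 and radii r(G) and r(H), respectively, γo(G □ H) ≤ n_1·n_2 − 2·r(G)·r(H), where γo denotes the global offensive alliance number. -/

import Mathlib

open SimpleGraph

/-- `S` is a global offensive alliance in `G`: every vertex outside `S` has at least
one more neighbor inside `S` than outside `S`. -/
def IsGlobalOffensiveAlliance {V : Type*} (G : SimpleGraph V) (S : Set V) : Prop :=
  ∀ v ∉ S, (G.neighborSet v ∩ S).ncard ≥ (G.neighborSet v \ S).ncard + 1

/-- `S` is a global strong offensive alliance in `G`. -/
def IsGlobalStrongOffensiveAlliance {V : Type*} (G : SimpleGraph V) (S : Set V) : Prop :=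
  ∀ v ∉ S, (G.neighborSet v ∩ S).ncard ≥ (G.neighborSet v \ S).ncard

/-- The global offensive alliance number `γₒ(G)`. -/
noncomputable def globalOffensiveAllianceNumber {V : Type*} (G : SimpleGraph V) : ℕ :=
  sInf {n | ∃ S : Set V, IsGlobalOffensiveAlliance G S ∧ S.ncard = n}

/-- `S` is a dominating set in `G`. -/
def IsDominatingSet {V : Type*} (G : SimpleGraph V) (S : Set V) : Prop :=
  ∀ v ∉ S, ∃ u ∈ S, G.Adj u v

/-- The domination number `γ(G)`. -/
noncomputable def dominationNumber {V : Type*} (G : SimpleGraph V) : ℕ :=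
  sInf {n | ∃ S : Set V, IsDominatingSet G S ∧ S.ncard = n}

/-- `S` is an efficient dominating set: a dominating set whose closed neighborhoods
are pairwise disjoint. -/
def IsEfficientDominatingSet {V : Type*} (G : SimpleGraph V) (S : Set V) : Prop :=
  IsDominatingSet G S ∧
    S.Pairwise fun u w =>
      Disjoint (insert u (G.neighborSet u)) (insert w (G.neighborSet w))

/-- The radius of a (connected, finite, nonempty) graph: the minimum over all vertices of
the maximum distance to any other vertex. -/
noncomputable def graphRadius {V : Type*} [Fintype V] [Nonempty V] (G : SimpleGraph V) : ℕ :=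
  Finset.univ.inf' Finset.univ_nonempty fun v => Finset.univ.sup fun u => G.dist v u

/-- On a geodesic from `a` to `b` there is a vertex at every intermediate distance. -/
theorem SimpleGraph.Connected.exists_geodesic {V : Type*} {G : SimpleGraph V}
    (hG : G.Connected) (a b : V) :
    ∃ f : ℕ → V, ∀ i ≤ G.dist a b, G.dist a (f i) = i ∧ G.dist (f i) b + i = G.dist a b := by
  obtain ⟨p, hp⟩ := hG.exists_walk_length_eq_dist a b
  refine ⟨p.getVert, fun i hi => ?_⟩
  have h1 : G.dist a (p.getVert i) ≤ i := by
    simpa [Walk.take_length, hp, hi] using dist_le (p.take i)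
  have h2 : G.dist (p.getVert i) b ≤ G.dist a b - i := by
    simpa [Walk.drop_length, hp] using dist_le (p.drop i)
  have h3 := hG.dist_triangle (u := a) (v := p.getVert i) (w := b)
  omega

theorem graphRadius_le {V : Type*} [Fintype V] [Nonempty V] (G : SimpleGraph V) (v : V) :
    graphRadius G ≤ Finset.univ.sup fun u => G.dist v u :=
  Finset.inf'_le _ (Finset.mem_univ v)

theorem exists_graphRadius_le_dist {V : Type*} [Fintype V] [Nonempty V] (G : SimpleGraph V)
    (v : V) : ∃ w, graphRadius G ≤ G.dist v w := by
  obtain ⟨w, -, hw⟩ := Finset.exists_mem_eq_sup Finset.univ Finset.univ_nonempty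
    fun u => G.dist v u
  exact ⟨w, hw ▸ graphRadius_le G v⟩

theorem exists_dist_le_graphRadius {V : Type*} [Fintype V] [Nonempty V] (G : SimpleGraph V) :
    ∃ c, ∀ w, G.dist c w ≤ graphRadius G := by
  obtain ⟨c, -, hc⟩ := Finset.exists_mem_eq_inf' (Finset.univ_nonempty (α := V))
    fun v => Finset.univ.sup fun u => G.dist v u
  refine ⟨c, fun w => ?_⟩
  rw [graphRadius, hc]
  exact Finset.le_sup (f := fun u => G.dist c u) (Finset.mem_univ w)

/-- A center `u` with as few vertices at distance `r` as possible, a neighbor `x` of `u` on a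
geodesic to some vertex `v` at distance `r`, and a vertex `w` from which `x` is farther
than `u`. -/
theorem exists_center_diverging {V : Type*} [Fintype V] [Nonempty V] (G : SimpleGraph V)
    (hG : G.Connected) (hr : 0 < graphRadius G) :
    ∃ u x v w, G.dist u x = 1 ∧ G.dist u v = graphRadius G ∧
      G.dist x v + 1 = graphRadius G ∧ G.dist x w = G.dist u w + 1 ∧
      graphRadius G ≤ G.dist u w + 1 := by
  classical
  set r := graphRadius G
  let far (c : V) : Finset V := {w | G.dist c w = r}
  obtain ⟨c, hc⟩ := exists_dist_le_graphRadius G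
  obtain ⟨u, hu, hmin⟩ := Finset.exists_min_image
    ({c | ∀ w, G.dist c w ≤ r} : Finset V) (fun c => (far c).card)
    ⟨c, by simpa using hc⟩
  simp only [Finset.mem_filter_univ] at hu hmin
  obtain ⟨v, hv⟩ := exists_graphRadius_le_dist G u
  have huv : G.dist u v = r := le_antisymm (hu v) hv
  obtain ⟨f, hf⟩ := hG.exists_geodesic u v
  obtain ⟨hux, hxv⟩ := hf 1 (by omega)
  generalize f 1 = x at hux hxv
  have htri (w : V) : G.dist x w ≤ G.dist u w + 1 := by
    have := hG.dist_triangle (u := x) (v := u) (w := w)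
    rw [G.dist_comm (u := x) (v := u), hux] at this
    omega
  refine ⟨u, x, v, ?_⟩
  suffices ∃ w, r ≤ G.dist x w ∧ G.dist u w < G.dist x w by
    obtain ⟨w, h1, h2⟩ := this
    have := htri w
    exact ⟨w, hux, huv, by omega, by omega, by omega⟩
  by_contra! hcon
  have hx (w : V) : G.dist x w ≤ r := by
    by_contra! h
    exact absurd (hu w) (by have := hcon w h.le; omega)
  refine absurd (hmin x hx) (not_le.2 (Finset.card_lt_card ?_))
  rw [Finset.ssubset_iff_of_subset]
  · exact ⟨v, by simpa [far] using huv, by simp [far]; omega⟩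
  · intro w hw
    simp only [far, Finset.mem_filter_univ] at hw ⊢
    exact le_antisymm (hu w) (hw ▸ hcon w hw.ge)

/-- A connected graph of radius `r` has an induced bipartite subgraph on at least `2 * r`
vertices. -/
theorem exists_disjoint_isIndepSet {V : Type*} [Fintype V] [Nonempty V] (G : SimpleGraph V)
    (hG : G.Connected) :
    ∃ A B : Finset V, Disjoint A B ∧ G.IsIndepSet (A : Set V) ∧ G.IsIndepSet (B : Set V) ∧
      B.card ≤ A.card ∧ 2 * graphRadius G ≤ A.card + B.card := by
  classical
  suffices h : ∃ A B : Finset V, Disjoint A B ∧ G.IsIndepSet (A : Set V) ∧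
      G.IsIndepSet (B : Set V) ∧ 2 * graphRadius G ≤ A.card + B.card by
    obtain ⟨A, B, hd, hA, hB, hcard⟩ := h
    rcases le_total B.card A.card with h | h
    · exact ⟨A, B, hd, hA, hB, h, hcard⟩
    · exact ⟨B, A, hd.symm, hB, hA, h, by omega⟩
  rcases Nat.eq_zero_or_pos (graphRadius G) with hr | hr
  · exact ⟨∅, ∅, by simp [hr, IsIndepSet]⟩
  obtain ⟨u, x, v, w, hux, huv, hxv, hxw, huw⟩ := exists_center_diverging G hG hr
  set r := graphRadius G
  obtain ⟨f, hf⟩ := hG.exists_geodesic x v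
  obtain ⟨g, hg⟩ := hG.exists_geodesic u w
  have huf (i : ℕ) (hi : i < r) : G.dist u (f i) = i + 1 := by
    have h1 := hf i (by omega)
    have h2 := hG.dist_triangle (u := u) (v := x) (w := f i)
    have h3 := hG.dist_triangle (u := u) (v := f i) (w := v)
    omega
  have hug (j : ℕ) (hj : j < r) : G.dist u (g j) = j := (hg j (by omega)).1
  have hfg (i j : ℕ) (hi : i < r) (hj : j < r) (hij : j = i + 1) :
      2 ≤ G.dist (f i) (g j) := by
    have h1 := hf i (by omega)
    have h2 := hg j (by omega)
    have h3 := hG.dist_triangle (u := x) (v := f i) (w := w)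
    have h4 := hG.dist_triangle (u := f i) (v := g j) (w := w)
    omega
  let P := (Finset.range r).image f
  let Q := (Finset.range r).image g
  have hP : P.card = r := by
    refine (Finset.card_image_of_injOn fun i hi j hj hij => ?_).trans (Finset.card_range r)
    have hi' := huf i (by simpa using hi)
    have hj' := huf j (by simpa using hj)
    simp only [hij] at hi'
    omega
  have hQ : Q.card = r := by
    refine (Finset.card_image_of_injOn fun i hi j hj hij => ?_).trans (Finset.card_range r)
    have hi' := hug i (by simpa using hi)
    have hj' := hug j (by simpa using hj)
    simp only [hij] at hi'
    omega
  have hPQ : Disjoint P Q := by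
    simp only [P, Q, Finset.disjoint_left, Finset.mem_image, Finset.mem_range]
    rintro _ ⟨i, hi, rfl⟩ ⟨j, hj, hij⟩
    have h1 := huf i hi
    have h2 := hug j hj
    rw [hij] at h2
    have h3 := hfg i j hi hj (by omega)
    simp [hij] at h3
  have hlayer (a b : V) (ha : a ∈ P ∪ Q) (hb : b ∈ P ∪ Q) (hab : G.Adj a b) :
      G.dist u a ≠ G.dist u b := by
    intro h
    have h1 : G.dist a b = 1 := dist_eq_one_iff_adj.2 hab
    simp only [P, Q, Finset.mem_union, Finset.mem_image, Finset.mem_range] at ha hb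
    rcases ha with ⟨i, hi, rfl⟩ | ⟨i, hi, rfl⟩ <;> rcases hb with ⟨j, hj, rfl⟩ | ⟨j, hj, rfl⟩
    · rw [huf i hi, huf j hj] at h
      obtain rfl : i = j := by omega
      exact hab.ne rfl
    · rw [huf i hi, hug j hj] at h
      have := hfg i j hi hj h.symm
      omega
    · rw [hug i hi, huf j hj] at h
      have := hfg j i hj hi h
      rw [G.dist_comm] at this
      omega
    · rw [hug i hi, hug j hj] at h
      exact hab.ne (h ▸ rfl)
  have hparity (a b : V) (ha : a ∈ P ∪ Q) (hb : b ∈ P ∪ Q) (hab : G.Adj a b) :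
      G.dist u a % 2 ≠ G.dist u b % 2 := by
    have h0 := hlayer a b ha hb hab
    have h1 : G.dist a b = 1 := dist_eq_one_iff_adj.2 hab
    have h2 := hG.dist_triangle (u := u) (v := a) (w := b)
    have h3 := hG.dist_triangle (u := u) (v := b) (w := a)
    rw [G.dist_comm (u := b) (v := a)] at h3
    omega
  refine ⟨(P ∪ Q).filter (G.dist u · % 2 = 0), (P ∪ Q).filter (¬ G.dist u · % 2 = 0),
    Finset.disjoint_filter_filter_not _ _ _, ?_, ?_, ?_⟩
  · intro a ha b hb _ hab
    simp only [Finset.coe_filter, Set.mem_ofPred_eq] at ha hb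
    exact hparity a b ha.1 hb.1 hab (by omega)
  · intro a ha b hb _ hab
    simp only [Finset.coe_filter, Set.mem_ofPred_eq] at ha hb
    exact hparity a b ha.1 hb.1 hab (by omega)
  · rw [Finset.card_filter_add_card_filter_not, Finset.card_union_of_disjoint hPQ, hP, hQ]
    omega

/-- The complement of an independent set is a global offensive alliance when no vertex is
isolated. -/
theorem isGlobalOffensiveAlliance_compl_of_isIndepSet {V : Type*} [Finite V]
    {G : SimpleGraph V} {I : Set V} (hI : G.IsIndepSet I) (hG : ∀ v, ∃ w, G.Adj v w) :
    IsGlobalOffensiveAlliance G Iᶜ := by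
  intro v hv
  rw [Set.notMem_compl_iff] at hv
  have hsub : G.neighborSet v ⊆ Iᶜ := fun w hw hwI => hI hv hwI (G.ne_of_adj hw) hw
  rw [Set.inter_eq_left.2 hsub, Set.sdiff_eq_empty.2 hsub, Set.ncard_empty, zero_add]
  obtain ⟨w, hw⟩ := hG v
  exact (Set.ncard_pos (Set.toFinite _)).2 ⟨w, hw⟩

theorem globalOffensiveAllianceNumber_le {V : Type*} {G : SimpleGraph V} {S : Set V}
    (hS : IsGlobalOffensiveAlliance G S) : globalOffensiveAllianceNumber G ≤ S.ncard :=
  Nat.sInf_le ⟨S, hS, rfl⟩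

theorem isIndepSet_boxProd {V W : Type*} {G : SimpleGraph V} {H : SimpleGraph W}
    {A B : Set V} {C D : Set W} (hAB : Disjoint A B) (hCD : Disjoint C D)
    (hA : G.IsIndepSet A) (hB : G.IsIndepSet B) (hC : H.IsIndepSet C) (hD : H.IsIndepSet D) :
    (G.boxProd H).IsIndepSet (A ×ˢ C ∪ B ×ˢ D) := by
  rw [Set.disjoint_left] at hAB hCD
  rintro ⟨a, c⟩ h1 ⟨b, d⟩ h2 - hadj
  simp only [Set.mem_union, Set.mem_prod] at h1 h2
  rw [boxProd_adj] at hadj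
  rcases hadj with ⟨hadj, h⟩ | ⟨hadj, h⟩ <;> dsimp only at hadj h <;> subst h <;>
    rcases h1 with ⟨h1, h1'⟩ | ⟨h1, h1'⟩ <;> rcases h2 with ⟨h2, h2'⟩ | ⟨h2, h2'⟩
  · exact hA h1 h2 hadj.ne hadj
  · exact hCD h1' h2'
  · exact hCD h2' h1'
  · exact hB h1 h2 hadj.ne hadj
  · exact hC h1' h2' hadj.ne hadj
  · exact hAB h1 h2
  · exact hAB h2 h1
  · exact hD h1' h2' hadj.ne hadj

theorem stmt7 {V W : Type*} [Fintype V] [Fintype W] [Nonempty V] [Nonempty W]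
    (G : SimpleGraph V) (H : SimpleGraph W) (hG : G.Connected) (hH : H.Connected) :
    (globalOffensiveAllianceNumber (G.boxProd H) : ℤ) ≤
      (Fintype.card V : ℤ) * (Fintype.card W : ℤ) -
        2 * (graphRadius G : ℤ) * (graphRadius H : ℤ) := by
  classical
  rcases Nat.eq_zero_or_pos (graphRadius G * graphRadius H) with h0 | hpos
  · have h := globalOffensiveAllianceNumber_le (G := G.boxProd H) (S := Set.univ)
      fun v hv => absurd (Set.mem_univ v) hv
    rw [Set.ncard_univ, Nat.card_eq_fintype_card, Fintype.card_prod] at h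
    zify at h h0
    linarith
  obtain ⟨A, B, hAB, hA, hB, hBA, hABr⟩ := exists_disjoint_isIndepSet G hG
  obtain ⟨C, D, hCD, hC, hD, hDC, hCDr⟩ := exists_disjoint_isIndepSet H hH
  have hnt : Nontrivial V := by
    obtain ⟨u, x, -, -, hux, -⟩ := exists_center_diverging G hG (Nat.pos_of_mul_pos_right hpos)
    exact ⟨u, x, (dist_eq_one_iff_adj.1 hux).ne⟩
  let I : Finset (V × W) := A ×ˢ C ∪ B ×ˢ D
  have hI : (G.boxProd H).IsIndepSet (I : Set (V × W)) := by
    simpa [I] using isIndepSet_boxProd (Finset.disjoint_coe.2 hAB) (Finset.disjoint_coe.2 hCD)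
      hA hB hC hD
  have hle := globalOffensiveAllianceNumber_le
    (isGlobalOffensiveAlliance_compl_of_isIndepSet hI
      fun v => (hG.boxProd hH).preconnected.exists_adj_of_nontrivial v)
  have hIcard : I.card = A.card * C.card + B.card * D.card := by
    rw [Finset.card_union_of_disjoint (Finset.disjoint_product.2 (.inl hAB)),
      Finset.card_product, Finset.card_product]
  have hcompl : (I : Set (V × W))ᶜ.ncard + I.card = Fintype.card V * Fintype.card W := by
    rw [← Finset.coe_compl, Set.ncard_coe_finset, Finset.card_compl_add_card,
      Fintype.card_prod]
  have hprod : 2 * graphRadius G * (2 * graphRadius H) ≤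
      (A.card + B.card) * (C.card + D.card) := Nat.mul_le_mul hABr hCDr
  zify at *
  nlinarith [mul_nonneg (sub_nonneg.2 hBA) (sub_nonneg.2 hDC)]
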